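/- Let r, M ≥ 1, let γ_1, …, γ_r be positive reals with the convention γ_{r+1} = 0, let H : ℝ² → ℝ be continuous, and let c ∈ ℝ. For an absolutely continuous cdf F with density f and support [0,∞) (i.e., f : ℝ → [0,∞) measurable, F(t) = ∫_{−∞}^t f, F(0) = 0, F strictly increasing on [0,∞), F(t) < 1 for all t, F(t) → 1 as t → ∞), let μ_F be the measure on ℝ^r with density f^X(x) = (∏_{j=1}^r γ_j) ∏_{j=1}^r (1−F(x_j))^{γ_j−γ_{j+1}−1} f(x_j) · 1{0 < x_1 < … < x_r} with respect to Lebesgue measure, and let μ_F^{⊗M} be its M-fold product on (ℝ^r)^M. For a sample x = (x_i^{(j)})_{1≤i≤M, 1≤j≤r} ∈ (ℝ^r)^M define n_k(s) = #{ l : x_k^{(l)} < s }, Y_{i,j} = ( Σ_{k=1}^{M} γ_{n_k(x_i^{(j)})+1} )^{−1}, and F̂(t; x) = 1 − ∏_{(i,j): x_i^{(j)} ≤ t} (1 − Y_{i,j}). Let G denote the standard uniform cdf (G(u) = u on [0,1]) with associated uniform-baseline GOS measure μ_G (density g_γ). Then μ_F^{⊗M}( { x : sup_{t>0} H(F̂(t;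 x), F(t)) ≤ c } ) = μ_G^{⊗M}( { u : sup_{v∈(0,1)} H(F̂(v; u), v) ≤ c } ). In particular, the distribution of the Kolmogorov–Smirnov type statistic sup_{t>0} H(F̂_γ(t), F(t)) is the same for every such baseline cdf F, which yields the exact confidence band of Theorem 1. -/

import Mathlib

open MeasureTheory Real Finset
open scoped Classical

lemma aux_lint {n : ℕ} (μ : Fin n → Measure ℝ) [∀ i, SigmaFinite (μ i)]
    (p : Fin n → ℝ → ENNReal) (hp : ∀ i, Measurable (p i)) :
    ∫⁻ x, ∏ i, p i (x i) ∂(Measure.pi μ) = ∏ i, ∫⁻ s, p i s ∂(μ i) := by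
  induction n with
  | zero => simp
  | succ n ih =>
    have hmp := (measurePreserving_piFinSuccAbove μ 0).symm
    rw [← hmp.lintegral_comp_emb (MeasurableEquiv.measurableEmbedding _)]
    simp_rw [MeasurableEquiv.piFinSuccAbove_symm_apply, Fin.insertNthEquiv,
        Fin.prod_univ_succ, Fin.insertNth_zero]
    simp only [Fin.zero_succAbove, Equiv.coe_fn_mk, Fin.cons_zero, Fin.cons_succ]
    rw [← ih (fun i => μ i.succ) (fun i => p i.succ) (fun i => hp _)]
    refine lintegral_prod_mul (μ := μ 0) (ν := Measure.pi fun i : Fin n => μ i.succ) (f := p 0) (g := fun x : Fin n → ℝ => ∏ i, p i.succ (x i)) (hp 0).aemeasurable ?_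
    refine (Finset.measurable_fun_prod _ fun i _ => ?_).aemeasurable
    exact (hp _).comp (measurable_pi_apply i)

lemma aux_pi_withDensity {n : ℕ} (p : ℝ → ENNReal) (hp : Measurable p)
    [SigmaFinite ((volume : Measure ℝ).withDensity p)] :
    Measure.pi (fun _ : Fin n => (volume : Measure ℝ).withDensity p) =
      (volume : Measure (Fin n → ℝ)).withDensity (fun x => ∏ i, p (x i)) := by
  refine Measure.pi_eq fun s hs => ?_
  rw [withDensity_apply _ (MeasurableSet.univ_pi hs), volume_pi, Measure.restrict_pi_pi,
    aux_lint _ (fun _ => p) (fun _ => hp)]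
  refine Finset.prod_congr rfl fun i _ => ?_
  rw [withDensity_apply _ (hs i)]

lemma aux_map_withDensity {α β : Type*} [MeasurableSpace α] [MeasurableSpace β]
    (μ : Measure α) (φ : α → β) (hφ : MeasurableEmbedding φ) (g : β → ENNReal) :
    (μ.withDensity (fun a => g (φ a))).map φ = (μ.map φ).withDensity g := by
  ext s hs
  rw [hφ.map_apply, withDensity_apply _ (hφ.measurable hs), withDensity_apply _ hs,
    hφ.restrict_map, hφ.lintegral_map]

noncomputable def auxFt (F : ℝ → ℝ) (t : ℝ) : ℝ := if 0 < t then F t else t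

lemma auxFt_mono (F : ℝ → ℝ) (hF0 : F 0 = 0) (hFmono : StrictMonoOn F (Set.Ici 0)) :
    StrictMono (auxFt F) := by
  intro a b hab
  unfold auxFt
  by_cases hb : 0 < b
  · have h0 : 0 < F b := hF0 ▸ hFmono (by simp) (by simpa using hb.le) hb
    by_cases ha : 0 < a
    · simp only [ha, hb, if_true]
      exact hFmono ha.le hb.le hab
    · simp only [ha, hb, if_true, if_false]; linarith
  · have ha : ¬ 0 < a := by linarith
    simpa [ha, hb] using hab

lemma aux_int (f : ℝ → ℝ)
    (F : ℝ → ℝ) (hF : ∀ t, F t = ∫ s in Set.Iic t, f s)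
    (hF0 : F 0 = 0) (hFmono : StrictMonoOn F (Set.Ici 0)) (t : ℝ) :
    IntegrableOn f (Set.Iic t) := by
  have h0 : 0 < F (max t 1) :=
    hF0 ▸ hFmono (by simp) (by simp) (lt_max_of_lt_right one_pos)
  have h1 : IntegrableOn f (Set.Iic (max t 1)) := by
    by_contra h
    rw [hF, integral_undef h] at h0
    exact lt_irrefl _ h0
  exact h1.mono_set (Set.Iic_subset_Iic.2 (le_max_left _ _))

lemma aux_nu_Iic (f : ℝ → ℝ) (hf_meas : Measurable f) (hf_nonneg : ∀ s, 0 ≤ f s)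
    (F : ℝ → ℝ) (hF : ∀ t, F t = ∫ s in Set.Iic t, f s)
    (hF0 : F 0 = 0) (hFmono : StrictMonoOn F (Set.Ici 0)) (t : ℝ) (ht : 0 ≤ t) :
    (volume.withDensity ((Set.Ioi (0:ℝ)).indicator fun s => ENNReal.ofReal (f s))) (Set.Iic t)
      = ENNReal.ofReal (F t) := by
  have hi := aux_int f F hF hF0 hFmono
  rw [withDensity_indicator measurableSet_Ioi, withDensity_apply _ measurableSet_Iic,
    Measure.restrict_restrict measurableSet_Iic, Set.inter_comm, Set.Ioi_inter_Iic,
    ← ofReal_integral_eq_lintegral_ofReal]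
  · rw [← intervalIntegral.integral_of_le ht, ← intervalIntegral.integral_Iic_sub_Iic (hi 0) (hi t),
      ← hF, ← hF, hF0, sub_zero]
  · exact (hi t).mono_set Set.Ioc_subset_Iic_self
  · exact Filter.Eventually.of_forall hf_nonneg

lemma aux_cont (f : ℝ → ℝ)
    (F : ℝ → ℝ) (hF : ∀ t, F t = ∫ s in Set.Iic t, f s)
    (hF0 : F 0 = 0) (hFmono : StrictMonoOn F (Set.Ici 0)) : Continuous F := by
  have hi := aux_int f F hF hF0 hFmono
  have : F = fun t => ∫ s in (0:ℝ)..t, f s := by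
    funext t
    rw [← intervalIntegral.integral_Iic_sub_Iic (hi 0) (hi t), ← hF, ← hF, hF0, sub_zero]
  rw [this]
  refine intervalIntegral.continuous_primitive (fun a b => ?_) 0
  refine ⟨(hi b).mono_set Set.Ioc_subset_Iic_self, (hi a).mono_set Set.Ioc_subset_Iic_self⟩

lemma aux_surj (f : ℝ → ℝ)
    (F : ℝ → ℝ) (hF : ∀ t, F t = ∫ s in Set.Iic t, f s)
    (hF0 : F 0 = 0) (hFmono : StrictMonoOn F (Set.Ici 0))
    (hFtop : Filter.Tendsto F Filter.atTop (nhds 1)) (v : ℝ) (h0 : 0 < v) (h1 : v < 1) :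
    ∃ t, 0 < t ∧ F t = v := by
  obtain ⟨T, hT, hT0⟩ := ((hFtop.eventually (lt_mem_nhds h1)).and
    (Filter.eventually_ge_atTop 0)).exists
  obtain ⟨t, ht, rfl⟩ := intermediate_value_Icc hT0 (aux_cont f F hF hF0 hFmono).continuousOn
    (show v ∈ Set.Icc (F 0) (F T) from ⟨by rw [hF0]; exact h0.le, hT.le⟩)
  refine ⟨t, lt_of_le_of_ne ht.1 ?_, rfl⟩
  rintro rfl
  rw [hF0] at h0
  exact lt_irrefl _ h0

lemma aux_nu (f : ℝ → ℝ) (hf_meas : Measurable f) (hf_nonneg : ∀ s, 0 ≤ f s)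
    (F : ℝ → ℝ) (hF : ∀ t, F t = ∫ s in Set.Iic t, f s)
    (hF0 : F 0 = 0) (hFmono : StrictMonoOn F (Set.Ici 0))
    (hFlt : ∀ t, F t < 1) (hFtop : Filter.Tendsto F Filter.atTop (nhds 1)) :
    IsFiniteMeasure (volume.withDensity
      ((Set.Ioi (0:ℝ)).indicator fun s => ENNReal.ofReal (f s))) ∧
    (volume.withDensity ((Set.Ioi (0:ℝ)).indicator fun s => ENNReal.ofReal (f s))).map (auxFt F)
      = volume.restrict (Set.Ioo 0 1) := by
  have hIic := aux_nu_Iic f hf_meas hf_nonneg F hF hF0 hFmono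
  set ν := volume.withDensity ((Set.Ioi (0:ℝ)).indicator fun s => ENNReal.ofReal (f s)) with hν
  have hmono := auxFt_mono F hF0 hFmono
  have huniv : ν Set.univ = 1 := by
    have h1 := tendsto_measure_Iic_atTop ν
    have h2 : Filter.Tendsto (fun t => ν (Set.Iic t)) Filter.atTop (nhds 1) := by
      have h3 := (ENNReal.continuous_ofReal.tendsto 1).comp hFtop
      rw [ENNReal.ofReal_one] at h3
      refine h3.congr' ?_
      filter_upwards [Filter.eventually_ge_atTop 0] with t ht
      exact (hIic t ht).symm
    exact tendsto_nhds_unique h1 h2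
  have hfin : IsFiniteMeasure ν := ⟨by rw [huniv]; exact ENNReal.one_lt_top⟩
  have hmeas : Measurable (auxFt F) := hmono.monotone.measurable
  refine ⟨hfin, ?_⟩
  refine Measure.ext_of_Iic _ _ fun a => ?_
  rw [Measure.map_apply hmeas measurableSet_Iic, Measure.restrict_apply measurableSet_Iic]
  rcases le_or_gt a 0 with ha | ha
  · have e1 : Set.Iic a ∩ Set.Ioo (0:ℝ) 1 = ∅ := by
      ext x; simp; intros; linarith
    rw [e1, measure_empty]
    refine measure_mono_null (t := Set.Iic 0) ?_ ?_
    · intro x hx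
      by_contra h
      have h' : auxFt F 0 < auxFt F x := hmono (by simpa using h)
      have h0 : auxFt F 0 = 0 := by simp [auxFt]
      have : auxFt F x ≤ a := hx
      linarith
    · rw [hIic 0 le_rfl, hF0, ENNReal.ofReal_zero]
  · rcases lt_or_ge a 1 with ha1 | ha1
    · obtain ⟨t, ht, hta⟩ := aux_surj f F hF hF0 hFmono hFtop a ha ha1
      have e1 : Set.Iic a ∩ Set.Ioo (0:ℝ) 1 = Set.Ioc 0 a := by
        ext x; simp; constructor
        · rintro ⟨h1, h2, h3⟩; exact ⟨h2, h1⟩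
        · rintro ⟨h1, h2⟩; exact ⟨h2, h1, by linarith⟩
      have e2 : auxFt F ⁻¹' Set.Iic a = Set.Iic t := by
        have : a = auxFt F t := by simp [auxFt, ht, hta]
        ext x
        simp [this, hmono.le_iff_le]
      rw [e1, e2, hIic t ht.le, hta]; simp
    · have e1 : Set.Iic a ∩ Set.Ioo (0:ℝ) 1 = Set.Ioo 0 1 := by
        ext x; simp; intros; linarith
      have e2 : auxFt F ⁻¹' Set.Iic a = Set.univ := by
        ext x
        simp only [Set.mem_preimage, Set.mem_Iic, Set.mem_univ, iff_true]
        unfold auxFt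
        split_ifs
        · exact (hFlt x).le.trans ha1
        · linarith
      rw [e1, e2, huniv]; simp

/-- Distribution-freeness of the Kolmogorov–Smirnov type statistic
sup_{t>0} H(F̂_γ(t), F(t)) with respect to the baseline cdf F, which yields the
exact confidence band of Theorem 1. -/
theorem stmt_14 (r M : ℕ) (hr : 1 ≤ r) (hM : 1 ≤ M) (γ : ℕ → ℝ)
    (hpos : ∀ j ∈ Finset.Icc 1 r, 0 < γ j) (hγtop : γ (r + 1) = 0)
    (H : ℝ → ℝ → ℝ) (hH : Continuous fun q : ℝ × ℝ => H q.1 q.2) (c : ℝ)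
    (f : ℝ → ℝ) (hf_meas : Measurable f) (hf_nonneg : ∀ s, 0 ≤ f s)
    (F : ℝ → ℝ) (hF : ∀ t, F t = ∫ s in Set.Iic t, f s)
    (hF0 : F 0 = 0) (hFmono : StrictMonoOn F (Set.Ici 0))
    (hFlt : ∀ t, F t < 1) (hFtop : Filter.Tendsto F Filter.atTop (nhds 1)) :
    (Measure.pi fun _ : Fin M =>
        volume.withDensity fun y : Fin r → ℝ =>
          ENNReal.ofReal
            (if (∀ i, 0 < y i) ∧ StrictMono y then
              (∏ j ∈ Finset.Icc 1 r, γ j) *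
                ∏ j : Fin r, ((1 - F (y j)) ^ (γ (j.1 + 1) - γ (j.1 + 2) - 1) * f (y j))
            else 0))
      {x : Fin M → Fin r → ℝ | ∀ t, 0 < t →
        H (1 - ∏ i : Fin M, ∏ j : Fin r,
            (if x i j ≤ t then
              1 - (∑ k : Fin M,
                γ ((Finset.univ.filter fun l : Fin r => x k l < x i j).card + 1))⁻¹
            else 1)) (F t) ≤ c}
    = (Measure.pi fun _ : Fin M =>
        volume.withDensity fun y : Fin r → ℝ =>
          ENNReal.ofReal
            (if (∀ i, 0 < y i ∧ y i < 1) ∧ StrictMono y then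
              (∏ j ∈ Finset.Icc 1 r, γ j) *
                ∏ j : Fin r, (1 - y j) ^ (γ (j.1 + 1) - γ (j.1 + 2) - 1)
            else 0))
      {x : Fin M → Fin r → ℝ | ∀ v, 0 < v → v < 1 →
        H (1 - ∏ i : Fin M, ∏ j : Fin r,
            (if x i j ≤ v then
              1 - (∑ k : Fin M,
                γ ((Finset.univ.filter fun l : Fin r => x k l < x i j).card + 1))⁻¹
            else 1)) v ≤ c} := by
  have hmono := auxFt_mono F hF0 hFmono
  have hmeas : Measurable (auxFt F) := hmono.monotone.measurable
  have hpos' : ∀ t, 0 < auxFt F t ↔ 0 < t := by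
    intro t
    have h0 : auxFt F 0 = 0 := by simp [auxFt]
    rw [← h0, hmono.lt_iff_lt, h0]
  have hlt1 : ∀ t, auxFt F t < 1 := by
    intro t
    unfold auxFt
    split_ifs
    · exact hFlt t
    · linarith
  have hFt : ∀ t, 0 < t → auxFt F t = F t := fun t ht => by simp [auxFt, ht]
  set g : (Fin r → ℝ) → ℝ := fun y => 
            (if (∀ i, 0 < y i ∧ y i < 1) ∧ StrictMono y then
              (∏ j ∈ Finset.Icc 1 r, γ j) *
                ∏ j : Fin r, (1 - y j) ^ (γ (j.1 + 1) - γ (j.1 + 2) - 1)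
            else 0) with hg
  have hgm : Measurable g := by
    refine Measurable.ite ?_ ?_ measurable_const
    · have : {y : Fin r → ℝ | (∀ i, 0 < y i ∧ y i < 1) ∧ StrictMono y} =
        (⋂ i, {y | 0 < y i} ∩ {y | y i < 1}) ∩ ⋂ i, ⋂ j, ⋂ (_ : i < j), {y | y i < y j} := by
        ext y
        simp [StrictMono]
      rw [this]
      refine MeasurableSet.inter (MeasurableSet.iInter fun i => MeasurableSet.inter ?_ ?_)
        (MeasurableSet.iInter fun i => MeasurableSet.iInter fun j => MeasurableSet.iInter fun _ => ?_)
      · exact measurableSet_lt measurable_const (measurable_pi_apply i)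
      · exact measurableSet_lt (measurable_pi_apply i) measurable_const
      · exact measurableSet_lt (measurable_pi_apply i) (measurable_pi_apply j)
    · refine measurable_const.mul (Finset.measurable_fun_prod _ fun j _ => ?_)
      exact (measurable_const.sub (measurable_pi_apply j)).pow_const _
  obtain ⟨hfin, hmap⟩ := aux_nu f hf_meas hf_nonneg F hF hF0 hFmono hFlt hFtop
  set p := ((Set.Ioi (0:ℝ)).indicator fun s => ENNReal.ofReal (f s)) with hp
  have hpm : Measurable p := hf_meas.ennreal_ofReal.indicator measurableSet_Ioi
  let φ : (Fin r → ℝ) → (Fin r → ℝ) := fun y i => auxFt F (y i)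
  have hφm : Measurable φ := measurable_pi_lambda _ fun i => hmeas.comp (measurable_pi_apply i)
  have hφi : Function.Injective φ := fun a b h => funext fun i => hmono.injective (congrFun h i)
  have hφ : MeasurableEmbedding φ := hφm.measurableEmbedding hφi
  let Φ : (Fin M → Fin r → ℝ) → (Fin M → Fin r → ℝ) := fun y i => φ (y i)
  have hΦm : Measurable Φ := measurable_pi_lambda _ fun i => hφm.comp (measurable_pi_apply i)
  have hΦ : MeasurableEmbedding Φ :=
    hΦm.measurableEmbedding fun a b h => funext fun i => hφi (congrFun h i)
  have hdens : (fun y : Fin r → ℝ => ENNReal.ofReal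
            (if (∀ i, 0 < y i) ∧ StrictMono y then
              (∏ j ∈ Finset.Icc 1 r, γ j) *
                ∏ j : Fin r, ((1 - F (y j)) ^ (γ (j.1 + 1) - γ (j.1 + 2) - 1) * f (y j))
            else 0)) = (fun y : Fin r → ℝ => ∏ i, p (y i)) * fun y => ENNReal.ofReal (g (φ y)) := by
    funext y
    have hiff : ((∀ i, 0 < φ y i ∧ φ y i < 1) ∧ StrictMono (φ y)) ↔
        ((∀ i, 0 < y i) ∧ StrictMono y) := by
      simp only [φ, hpos', hlt1, and_true, StrictMono, hmono.lt_iff_lt]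
    simp only [Pi.mul_apply, hg, hiff]
    split_ifs with h
    · have e1 : ∏ i, p (y i) = ENNReal.ofReal (∏ i, f (y i)) := by
        rw [ENNReal.ofReal_prod_of_nonneg (fun i _ => hf_nonneg _)]
        refine Finset.prod_congr rfl fun i _ => ?_
        rw [hp, Set.indicator_of_mem (show y i ∈ Set.Ioi (0:ℝ) from h.1 i)]
      have e2 : ∀ i, φ y i = F (y i) := fun i => hFt _ (h.1 i)
      simp only [e2]
      rw [e1, ← ENNReal.ofReal_mul (Finset.prod_nonneg fun i _ => hf_nonneg _),
        Finset.prod_mul_distrib]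
      congr 1
      ring
    · simp
  have hone : (volume.withDensity (fun y : Fin r → ℝ => ENNReal.ofReal
            (if (∀ i, 0 < y i) ∧ StrictMono y then
              (∏ j ∈ Finset.Icc 1 r, γ j) *
                ∏ j : Fin r, ((1 - F (y j)) ^ (γ (j.1 + 1) - γ (j.1 + 2) - 1) * f (y j))
            else 0))).map φ = volume.withDensity fun y => ENNReal.ofReal (g y) := by
    rw [hdens, withDensity_mul]
    rotate_left
    · exact Finset.measurable_fun_prod _ fun i _ => hpm.comp (measurable_pi_apply i)
    · exact (hgm.comp hφm).ennreal_ofReal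
    rw [aux_map_withDensity _ φ hφ (fun y => ENNReal.ofReal (g y)), ← aux_pi_withDensity p hpm]
    haveI : SigmaFinite ((volume.withDensity p).map (auxFt F)) := by
      rw [hmap]; infer_instance
    have e3 := Measure.pi_map_pi (μ := fun _ : Fin r => volume.withDensity p)
      (f := fun _ => auxFt F) (fun _ => hmeas.aemeasurable)
    have hbox : MeasurableSet (Set.univ.pi fun _ : Fin r => Set.Ioo (0:ℝ) 1) :=
      MeasurableSet.univ_pi fun _ => measurableSet_Ioo
    change ((Measure.pi fun _ : Fin r => volume.withDensity p).map
      (fun x i => auxFt F (x i))).withDensity _ = _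
    rw [e3, hmap, ← Measure.restrict_pi_pi, ← volume_pi, ← withDensity_indicator hbox]
    congr 1
    funext y
    by_cases hy : y ∈ Set.univ.pi fun _ : Fin r => Set.Ioo (0:ℝ) 1
    · rw [Set.indicator_of_mem hy]
    · rw [Set.indicator_of_notMem hy, hg]
      have : ¬ ((∀ i, 0 < y i ∧ y i < 1) ∧ StrictMono y) := fun h => hy fun i _ => h.1 i
      simp [this]
  rw [← hone]
  haveI : SigmaFinite ((volume.withDensity (fun y : Fin r → ℝ => ENNReal.ofReal
            (if (∀ i, 0 < y i) ∧ StrictMono y then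
              (∏ j ∈ Finset.Icc 1 r, γ j) *
                ∏ j : Fin r, ((1 - F (y j)) ^ (γ (j.1 + 1) - γ (j.1 + 2) - 1) * f (y j))
            else 0))).map φ) := by
    rw [hone]; infer_instance
  rw [← Measure.pi_map_pi (fun _ => hφm.aemeasurable)]
  change _ = (Measure.map Φ _) _
  rw [hΦ.map_apply]
  congr 1
  ext x
  simp only [Set.mem_setOf_eq, Set.mem_preimage, Φ, φ, hmono.lt_iff_lt]
  constructor
  · intro h v hv0 hv1
    obtain ⟨t, ht, rfl⟩ := aux_surj f F hF hF0 hFmono hFtop v hv0 hv1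
    have := h t ht
    rw [← hFt t ht]
    simp only [hmono.le_iff_le]
    rw [hFt t ht]
    exact this
  · intro h t ht
    have := h (auxFt F t) ((hpos' t).2 ht) (hlt1 t)
    simp only [hmono.le_iff_le] at this
    rw [hFt t ht] at this
    exact this
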